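/- arXiv:2408.14880 — 3 statements merged into one kernel-verified Lean document; each statement's English description precedes it below -/
import Mathlib

section
/- Let A ⊆ B be an inclusion of a subalgebra into a C*-algebra B. The following are equivalent: (1) the inclusion A ⊆ B has the ideal separation property; (2) for every closed two-sided ideal I ⊆ B, the inclusion (A + I)/I ⊆ B/I has the ideal intersection property; (3) every closed two-sided ideal I ⊆ B equals the closed two-sided ideal of B generated by I ∩ A; (4) for any closed two-sided ideals I, J ⊆ B, I ∩ A ⊆ J ∩ A implies I ⊆ J. -/
/-- A subset `A` of a topological nonunital ring `B` has the *ideal separation property*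
(ISP), i.e. `A` separates the closed two-sided ideals of `B`. -/
def SepIdeals {B : Type*} [NonUnitalNonAssocRing B] [TopologicalSpace B] (A : Set B) : Prop :=
  ∀ I J : TwoSidedIdeal B, IsClosed (I : Set B) → IsClosed (J : Set B) →
    (I : Set B) ∩ A = (J : Set B) ∩ A → I = J

/-- A subset `A` of a topological nonunital ring `B` has the *ideal intersection property*
(IIP), i.e. `A` detects the closed two-sided ideals of `B`. -/
def DetIdeals {B : Type*} [NonUnitalNonAssocRing B] [TopologicalSpace B] (A : Set B) : Prop :=
  ∀ I : TwoSidedIdeal B, IsClosed (I : Set B) → I ≠ ⊥ → (I : Set B) ∩ A ≠ {0}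

/-- The quotient of a topological ring by a ring congruence carries the quotient topology. -/
instance {B : Type*} [Add B] [Mul B] [TopologicalSpace B] (c : RingCon B) :
    TopologicalSpace c.Quotient :=
  instTopologicalSpaceQuotient

/-- The smallest closed two-sided ideal of `B` containing a subset `S`. -/
def closedIdealGeneratedBy {B : Type*} [NonUnitalNonAssocRing B] [TopologicalSpace B]
    (S : Set B) : TwoSidedIdeal B :=
  sInf {J : TwoSidedIdeal B | S ⊆ (J : Set B) ∧ IsClosed (J : Set B)}

theorem closedIdealGeneratedBy_le {B : Type*} [NonUnitalNonAssocRing B] [TopologicalSpace B]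
    {S : Set B} {J : TwoSidedIdeal B} (hS : S ⊆ (J : Set B)) (hJ : IsClosed (J : Set B)) :
    closedIdealGeneratedBy S ≤ J :=
  sInf_le ⟨hS, hJ⟩

theorem coe_closedIdealGeneratedBy {B : Type*} [NonUnitalNonAssocRing B] [TopologicalSpace B]
    (S : Set B) : (closedIdealGeneratedBy S : Set B) =
      ⋂ J ∈ {J : TwoSidedIdeal B | S ⊆ (J : Set B) ∧ IsClosed (J : Set B)}, (J : Set B) := by
  ext x
  simp [closedIdealGeneratedBy, TwoSidedIdeal.mem_sInf]

theorem subset_closedIdealGeneratedBy {B : Type*} [NonUnitalNonAssocRing B] [TopologicalSpace B]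
    (S : Set B) : S ⊆ (closedIdealGeneratedBy S : Set B) := by
  rw [coe_closedIdealGeneratedBy]
  exact Set.subset_iInter₂ fun J hJ => hJ.1

theorem isClosed_closedIdealGeneratedBy {B : Type*} [NonUnitalNonAssocRing B]
    [TopologicalSpace B] (S : Set B) : IsClosed (closedIdealGeneratedBy S : Set B) := by
  rw [coe_closedIdealGeneratedBy]
  exact isClosed_biInter fun J hJ => hJ.2

theorem TwoSidedIdeal.quotient_coe_eq_zero_iff {B : Type*} [NonUnitalNonAssocRing B]
    (I : TwoSidedIdeal B) (b : B) : (b : I.ringCon.Quotient) = 0 ↔ b ∈ I := by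
  rw [TwoSidedIdeal.mem_iff, ← RingCon.coe_zero, RingCon.eq]

/-- The preimage in `B` of a two-sided ideal of `B/I`. -/
def TwoSidedIdeal.quotientPreimage {B : Type*} [NonUnitalNonAssocRing B] (I : TwoSidedIdeal B)
    (K : TwoSidedIdeal I.ringCon.Quotient) : TwoSidedIdeal B :=
  .mk' {b | (b : I.ringCon.Quotient) ∈ K} K.zero_mem
    (fun hx hy => K.add_mem hx hy) (fun hx => K.neg_mem hx)
    (fun {x y} hy => K.mul_mem_left x y hy) (fun {x y} hx => K.mul_mem_right x y hx)

theorem TwoSidedIdeal.coe_quotientPreimage {B : Type*} [NonUnitalNonAssocRing B]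
    (I : TwoSidedIdeal B) (K : TwoSidedIdeal I.ringCon.Quotient) :
    (I.quotientPreimage K : Set B) = (fun b : B => (b : I.ringCon.Quotient)) ⁻¹' K :=
  TwoSidedIdeal.coe_mk' ..

/-- The image in `B/I` of a two-sided ideal of `B`. -/
def TwoSidedIdeal.quotientImage {B : Type*} [NonUnitalNonAssocRing B] (I J : TwoSidedIdeal B) :
    TwoSidedIdeal I.ringCon.Quotient :=
  .mk' ((fun b : B => (b : I.ringCon.Quotient)) '' J) ⟨0, J.zero_mem, rfl⟩
    (by rintro _ _ ⟨x, hx, rfl⟩ ⟨y, hy, rfl⟩; exact ⟨x + y, J.add_mem hx hy, rfl⟩)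
    (by rintro _ ⟨x, hx, rfl⟩; exact ⟨-x, J.neg_mem hx, rfl⟩)
    (by
      rintro q _ ⟨y, hy, rfl⟩
      obtain ⟨x, rfl⟩ := Quotient.exists_rep q
      exact ⟨x * y, J.mul_mem_left _ _ hy, rfl⟩)
    (by
      rintro _ q ⟨x, hx, rfl⟩
      obtain ⟨y, rfl⟩ := Quotient.exists_rep q
      exact ⟨x * y, J.mul_mem_right _ _ hx, rfl⟩)

theorem TwoSidedIdeal.coe_quotientImage {B : Type*} [NonUnitalNonAssocRing B]
    (I J : TwoSidedIdeal B) :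
    (I.quotientImage J : Set I.ringCon.Quotient) =
      (fun b : B => (b : I.ringCon.Quotient)) '' J :=
  TwoSidedIdeal.coe_mk' ..

theorem TwoSidedIdeal.coe_mem_quotientImage_iff {B : Type*} [NonUnitalNonAssocRing B]
    {I J : TwoSidedIdeal B} (h : I ≤ J) (b : B) :
    (b : I.ringCon.Quotient) ∈ I.quotientImage J ↔ b ∈ J := by
  rw [← SetLike.mem_coe, TwoSidedIdeal.coe_quotientImage]
  refine ⟨?_, fun hb => ⟨b, hb, rfl⟩⟩
  rintro ⟨x, hx, hxb⟩
  have hI : b - x ∈ I := (I.rel_iff b x).1 ((RingCon.eq _).1 hxb.symm)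
  simpa using J.add_mem (h hI) hx

theorem SepIdeals.detIdeals_quotient {B : Type*} [NonUnitalNonAssocRing B] [TopologicalSpace B]
    {A : Set B} (hA : SepIdeals A) (I : TwoSidedIdeal B) (hI : IsClosed (I : Set B)) :
    DetIdeals ((fun b : B => (b : I.ringCon.Quotient)) '' A) := by
  intro K hK hne hK0
  refine hne (le_bot_iff.1 fun q hq => ?_)
  have hcl : IsClosed (I.quotientPreimage K : Set B) := by
    rw [TwoSidedIdeal.coe_quotientPreimage]
    exact hK.preimage continuous_quotient_mk'
  have hEq : I.quotientPreimage K = I := by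
    refine hA _ _ hcl hI (Set.ext fun a => and_congr_left fun ha => ?_)
    rw [TwoSidedIdeal.coe_quotientPreimage]
    refine ⟨fun h => ?_, fun h => ?_⟩
    · have : (a : I.ringCon.Quotient) ∈ (K : Set I.ringCon.Quotient) ∩
          ((fun b : B => (b : I.ringCon.Quotient)) '' A) := ⟨h, a, ha, rfl⟩
      rw [hK0] at this
      exact (I.quotient_coe_eq_zero_iff a).1 this
    · have h0 := (I.quotient_coe_eq_zero_iff a).2 h
      change (a : I.ringCon.Quotient) ∈ K
      rw [h0]
      exact K.zero_mem
  obtain ⟨b, rfl⟩ := Quotient.exists_rep q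
  have hb : b ∈ (I.quotientPreimage K : Set B) := by
    rw [TwoSidedIdeal.coe_quotientPreimage]
    exact hq
  rw [hEq] at hb
  exact (TwoSidedIdeal.mem_bot _).2 ((I.quotient_coe_eq_zero_iff b).2 hb)

theorem le_of_detIdeals_quotient_inf {B : Type*} [NonUnitalNonAssocRing B] [TopologicalSpace B]
    {A : Set B} (h0 : (0 : B) ∈ A) {I J : TwoSidedIdeal B} (hI : IsClosed (I : Set B))
    (hA : DetIdeals ((fun b : B => (b : (I ⊓ J).ringCon.Quotient)) '' A))
    (hIJ : (I : Set B) ∩ A ⊆ (J : Set B) ∩ A) : I ≤ J := by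
  by_contra hle
  have hinf : I ⊓ J ≤ I := inf_le_left
  refine hA ((I ⊓ J).quotientImage I) ?_ ?_ ?_
  · refine isQuotientMap_quotient_mk'.isClosed_preimage.1 ?_
    convert hI using 1
    exact Set.ext fun b => TwoSidedIdeal.coe_mem_quotientImage_iff hinf b
  · intro hbot
    refine hle fun b hb => ?_
    have hmem := (TwoSidedIdeal.coe_mem_quotientImage_iff hinf b).2 hb
    rw [hbot, TwoSidedIdeal.mem_bot, TwoSidedIdeal.quotient_coe_eq_zero_iff] at hmem
    exact (inf_le_right : I ⊓ J ≤ J) hmem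
  · refine Set.eq_singleton_iff_unique_mem.2
      ⟨⟨TwoSidedIdeal.zero_mem _, 0, h0, rfl⟩, ?_⟩
    rintro _ ⟨hq, a, ha, rfl⟩
    have haI : a ∈ I := (TwoSidedIdeal.coe_mem_quotientImage_iff hinf a).1 hq
    exact ((I ⊓ J).quotient_coe_eq_zero_iff a).2
      ((TwoSidedIdeal.mem_inf _).2 ⟨haI, (hIJ ⟨haI, ha⟩).1⟩)

/-- For a subalgebra `A` of a C*-algebra `B`, the following are equivalent:
(1) the inclusion `A ⊆ B` has the ideal separation property;
(2) for every closed two-sided ideal `I ⊆ B`, the image `(A + I)/I` of `A` in the quotient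
    `B/I` has the ideal intersection property;
(3) every closed two-sided ideal `I ⊆ B` equals the closed two-sided ideal of `B` generated
    by `I ∩ A`;
(4) for any closed two-sided ideals `I, J ⊆ B`, `I ∩ A ⊆ J ∩ A` implies `I ⊆ J`. -/
theorem charISP_general {B : Type*} [NonUnitalCStarAlgebra B] (A : NonUnitalSubalgebra ℂ B) :
    List.TFAE
      [ SepIdeals (A : Set B),
        ∀ I : TwoSidedIdeal B, IsClosed (I : Set B) →
          DetIdeals ((fun b : B => (b : I.ringCon.Quotient)) '' (A : Set B)),
        ∀ I : TwoSidedIdeal B, IsClosed (I : Set B) →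
          I = closedIdealGeneratedBy ((I : Set B) ∩ (A : Set B)),
        ∀ I J : TwoSidedIdeal B, IsClosed (I : Set B) → IsClosed (J : Set B) →
          (I : Set B) ∩ (A : Set B) ⊆ (J : Set B) ∩ (A : Set B) → I ≤ J ] := by
  tfae_have 1 → 2 := fun h I hI => h.detIdeals_quotient I hI
  tfae_have 2 → 4 := fun h I J hI hJ hIJ =>
    le_of_detIdeals_quotient_inf A.zero_mem hI (h (I ⊓ J) (by
      have : ((I ⊓ J : TwoSidedIdeal B) : Set B) = (I : Set B) ∩ J :=
        Set.ext fun _ => TwoSidedIdeal.mem_inf _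
      rw [this]
      exact hI.inter hJ)) hIJ
  tfae_have 4 → 3 := fun h I hI => le_antisymm
    (h _ _ hI (isClosed_closedIdealGeneratedBy _)
      fun _ hx => ⟨subset_closedIdealGeneratedBy _ hx, hx.2⟩)
    (closedIdealGeneratedBy_le Set.inter_subset_left hI)
  tfae_have 3 → 1 := fun h I J hI hJ hIJ => by rw [h I hI, h J hJ, hIJ]
  tfae_finish
end

section
/- Let A ⊆ B be an inclusion of a dense *-subalgebra into a C*-algebra B, and let Ψ : Π_B → Π*_A be the map P ↦ P ∩ A. The following are equivalent: (1) the inclusion A ⊆ B has the ideal intersection property; (2) a subset Y ⊆ Π_B is dense in Π_B if (and only if) Ψ(Y) is dense in the range of Ψ; (3) for every closed proper subset K ⊆ Π_B there exists a nonzero f ∈ A with f ∈ k_B(K). -/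
universe u

/-- A `*`-representation of a complex `*`-algebra `A` on a complex Hilbert space. -/
structure StarRep (A : Type u) [NonUnitalNonAssocRing A] [Module ℂ A] [Star A] :
    Type (u + 1) where
  /-- The Hilbert space of the representation. -/
  H : Type u
  [ng : NormedAddCommGroup H]
  [ip : InnerProductSpace ℂ H]
  [cp : CompleteSpace H]
  /-- The underlying `*`-homomorphism into the bounded operators. -/
  π : A →⋆ₙₐ[ℂ] (H →L[ℂ] H)

attribute [instance] StarRep.ng StarRep.ip StarRep.cp

/-- A `*`-representation is topologically irreducible if it is nonzero and admits no
closed invariant subspace other than `⊥` and `⊤`. -/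
def StarRep.IsTopIrred {A : Type u} [NonUnitalNonAssocRing A] [Module ℂ A] [Star A]
    (ρ : StarRep A) : Prop :=
  (∃ a, ρ.π a ≠ 0) ∧
    ∀ K : Submodule ℂ ρ.H, IsClosed (K : Set ρ.H) →
      (∀ (a : A) (x : ρ.H), x ∈ K → ρ.π a x ∈ K) → K = ⊥ ∨ K = ⊤

variable (A : Type u) [NonUnitalNonAssocRing A] [Module ℂ A] [Star A]

/-- `P ⊆ A` is the kernel of some topologically irreducible `*`-representation of `A`. -/
def IsIrrepKernel (P : Set A) : Prop :=
  ∃ ρ : StarRep A, ρ.IsTopIrred ∧ P = {a : A | ρ.π a = 0}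

/-- The `*`-structure space `Π*_A` of `A`: the collection of kernels of topologically
irreducible `*`-representations of `A` (for a C*-algebra this is the primitive ideal
space), viewed as a collection of subsets of `A`. -/
def starStructureSpace : Set (Set A) := {P | IsIrrepKernel A P}

/-- The hull `h(S)` of a subset `S ⊆ A`: all points of the `*`-structure space
containing `S`. -/
def hkHull (S : Set A) : Set (Set A) := {P ∈ starStructureSpace A | S ⊆ P}

/-- The hull-kernel closure `h(k(Y))` of a collection `Y` of points of the `*`-structure
space.  (`k(Y) = ⋂₀ Y` is the kernel of `Y`.) -/
def hkClosure (Y : Set (Set A)) : Set (Set A) := hkHull A (⋂₀ Y)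

/-- A subset `K` of the `*`-structure space is closed (for the hull-kernel topology)
iff `K = h(k(K))`. -/
def IsHKClosed (K : Set (Set A)) : Prop := K ⊆ starStructureSpace A ∧ K = hkClosure A K

section UnitalCStarAlgebra

open scoped ComplexOrder InnerProductSpace ComplexStarModule

variable {U : Type u} [CStarAlgebra U] [PartialOrder U]

/-- The states of `U` that vanish on `J`, as a subset of the space of all functions. -/
def TwoSidedIdeal.annihilatingStates (J : TwoSidedIdeal U) : Set (U → ℂ) :=
  {F | ∃ φ : U →ₗ[ℂ] ℂ, ⇑φ = F ∧ (∀ p, 0 ≤ p → 0 ≤ φ p) ∧ φ 1 = 1 ∧ ∀ j ∈ J, φ j = 0}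

theorem TwoSidedIdeal.isClosed_annihilatingStates (J : TwoSidedIdeal U) :
    IsClosed J.annihilatingStates := by
  have : J.annihilatingStates = Set.range ((↑) : (U →ₗ[ℂ] ℂ) → U → ℂ) ∩
      ((⋂ p : U, ⋂ _ : 0 ≤ p, {F | 0 ≤ F p}) ∩ ({F | F 1 = 1} ∩ ⋂ j ∈ J, {F | F j = 0})) := by
    ext F
    simp only [annihilatingStates, Set.mem_ofPred_eq, Set.mem_inter_iff, Set.mem_range,
      Set.mem_iInter]
    constructor
    · rintro ⟨φ, rfl, h1, h2, h3⟩
      exact ⟨⟨φ, rfl⟩, h1, h2, h3⟩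
    · rintro ⟨⟨φ, rfl⟩, h1, h2, h3⟩
      exact ⟨φ, rfl, h1, h2, h3⟩
  rw [this]
  refine (LinearMap.isClosed_range_coe U ℂ (RingHom.id ℂ)).inter
    (IsClosed.inter ?_ (IsClosed.inter ?_ ?_))
  · exact isClosed_iInter fun p => isClosed_iInter fun _ =>
      isClosed_le continuous_const (continuous_apply p)
  · exact isClosed_eq (continuous_apply 1) continuous_const
  · exact isClosed_iInter fun p => isClosed_iInter fun _ =>
      isClosed_eq (continuous_apply p) continuous_const

theorem TwoSidedIdeal.eq_zero_of_extreme_annihilatingStates {J : TwoSidedIdeal U}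
    {φ : U →ₗ[ℂ] ℂ} (hφ : ⇑φ ∈ J.annihilatingStates.extremePoints ℝ) {D : U →ₗ[ℂ] ℂ}
    (hone : D 1 = 0) (hadd : ∀ p, 0 ≤ p → 0 ≤ φ p + D p) (hsub : ∀ p, 0 ≤ p → 0 ≤ φ p - D p)
    (hzero : ∀ j ∈ J, D j = 0) : D = 0 := by
  obtain ⟨⟨φ', hφ', -, h1, h0⟩, hext⟩ := mem_extremePoints.1 hφ
  obtain rfl : φ' = φ := DFunLike.coe_injective hφ'
  have hp : ⇑(φ' + D) ∈ J.annihilatingStates :=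
    ⟨φ' + D, rfl, hadd, by simp [h1, hone], fun j hj => by simp [h0 j hj, hzero j hj]⟩
  have hm : ⇑(φ' - D) ∈ J.annihilatingStates :=
    ⟨φ' - D, rfl, hsub, by simp [h1, hone], fun j hj => by simp [h0 j hj, hzero j hj]⟩
  have heq := (hext _ hp _ hm ⟨1 / 2, 1 / 2, by norm_num, by norm_num, by norm_num, by
    ext x
    simp
    ring⟩).1
  exact add_eq_left.1 (DFunLike.coe_injective heq)

variable [StarOrderedRing U]

/-- An element whose square is dominated modulo a closed ideal by every positive scalar belongs
to the ideal. -/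
theorem TwoSidedIdeal.mem_of_forall_star_mul_self_le {J : TwoSidedIdeal U}
    (hJ : IsClosed (J : Set U)) {b : U}
    (h : ∀ t : ℝ, 0 < t → ∃ j ∈ J, IsSelfAdjoint j ∧ star b * b ≤ algebraMap ℝ U t + j) :
    b ∈ J := by
  rw [← SetLike.mem_coe, ← hJ.closure_eq, Metric.mem_closure_iff]
  intro ε hε
  set t : ℝ := ε ^ 2 / 4 with ht
  have ht0 : 0 < t := by positivity
  obtain ⟨j, hj, hsa, hle⟩ := h t ht0
  have hden : ∀ x : ℝ, t ^ 2 + x ^ 2 ≠ 0 := fun x => by positivity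
  set g : ℝ → ℝ := fun x => t ^ 2 / (t ^ 2 + x ^ 2) with hg
  set k : ℝ → ℝ := fun x => x / (t ^ 2 + x ^ 2) with hk
  have hgc : Continuous g := by fun_prop (disch := exact hden _)
  have hkc : Continuous k := by fun_prop (disch := exact hden _)
  have hgsa : star (cfc g j) = cfc g j := (cfc_predicate g j : IsSelfAdjoint _)
  have hsum : cfc g j + cfc k j * j = 1 := by
    conv_lhs => enter [2, 2]; rw [← cfc_id ℝ j]
    rw [← cfc_mul k id j, ← cfc_add j g _, ← cfc_one ℝ j]
    refine cfc_congr fun x _ => ?_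
    have := hden x
    simp only [hg, hk, id, Pi.one_apply]
    field_simp
  refine ⟨b * (cfc k j * j), J.mul_mem_left _ _ (J.mul_mem_left _ _ hj), ?_⟩
  have hsub : b - b * (cfc k j * j) = b * cfc g j := by
    rw [← eq_sub_iff_add_eq] at hsum
    rw [hsum, mul_sub, mul_one]
  have hbound : star (b * cfc g j) * (b * cfc g j) ≤ algebraMap ℝ U (2 * t) := by
    have h1 := star_left_conjugate_le_conjugate hle (cfc g j)
    have h2 : star (cfc g j) * (algebraMap ℝ U t + j) * cfc g j =
        cfc (fun x => g x * (t + x) * g x) j := by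
      rw [cfc_mul (fun x => g x * (t + x)) g j, cfc_mul g (fun x => t + x) j,
        cfc_add j (fun _ => t) (fun x => x), cfc_const t j, cfc_id' ℝ j, hgsa]
    rw [star_mul, mul_assoc, ← mul_assoc (star b), ← mul_assoc]
    refine h1.trans (h2.trans_le ?_)
    refine cfc_le_algebraMap _ _ _ fun x _ => ?_
    have h3 : g x * (t + x) * g x = t ^ 4 * (t + x) / (t ^ 2 + x ^ 2) ^ 2 := by
      have := hden x
      simp only [hg]
      field_simp
    rw [h3, div_le_iff₀ (by positivity)]
    nlinarith [sq_nonneg (t - x), mul_pos ht0 (pow_pos ht0 3), pow_pos ht0 3,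
      mul_nonneg (pow_pos ht0 3).le (sq_nonneg (t - x)),
      mul_nonneg (pow_pos ht0 3).le (sq_nonneg x), mul_nonneg ht0.le (pow_nonneg (sq_nonneg x) 2)]
  rw [dist_eq_norm, hsub]
  have h4 := (CStarAlgebra.norm_le_iff_le_algebraMap _ (by positivity)
    (star_mul_self_nonneg _)).2 hbound
  rw [CStarRing.norm_star_mul_self] at h4
  by_contra! h5
  nlinarith [mul_self_le_mul_self hε.le h5]

theorem TwoSidedIdeal.star_mem_of_isClosed {J : TwoSidedIdeal U}
    (hJ : IsClosed (J : Set U)) {c : U} (hc : c ∈ J) : star c ∈ J := by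
  refine mem_of_forall_star_mul_self_le hJ fun t ht =>
    ⟨c * star c, J.mul_mem_right _ _ hc, .mul_star_self c, ?_⟩
  rw [star_star]
  exact le_add_of_nonneg_left (algebraMap_nonneg U ht.le)

theorem TwoSidedIdeal.isCompact_annihilatingStates (J : TwoSidedIdeal U) :
    IsCompact J.annihilatingStates := by
  refine IsCompact.of_isClosed_subset
    (isCompact_univ_pi fun x : U => isCompact_closedBall (0 : ℂ) (‖x‖ + ‖x‖))
    J.isClosed_annihilatingStates ?_
  rintro _ ⟨φ, rfl, hpos, hone, -⟩ x -
  have hsa : ∀ y : selfAdjoint U, ‖φ y‖ ≤ ‖y‖ := fun y => by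
    have h1 := hpos _ (sub_nonneg.2 y.2.le_algebraMap_norm_self)
    have h2 := hpos _ (sub_nonneg.2 (-y).2.le_algebraMap_norm_self)
    have hr : φ (algebraMap ℝ U ‖(y : U)‖) = (‖(y : U)‖ : ℝ) := by
      rw [IsScalarTower.algebraMap_apply ℝ ℂ U, Algebra.algebraMap_eq_smul_one, map_smul, hone]
      simp
    simp only [NegMemClass.coe_neg, norm_neg, map_sub, map_neg, hr] at h1 h2
    have him : (φ y).im = 0 := by simpa using (Complex.le_def.1 h1).2
    have hre1 := (Complex.le_def.1 h1).1
    have hre2 := (Complex.le_def.1 h2).1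
    simp only [Complex.zero_re, Complex.sub_re, Complex.ofReal_re, Complex.neg_re] at hre1 hre2
    rw [← Complex.abs_re_eq_norm.2 him, abs_le]
    change -‖(y : U)‖ ≤ _ ∧ _ ≤ ‖(y : U)‖
    constructor <;> linarith
  rw [mem_closedBall_zero_iff]
  conv_lhs => rw [← realPart_add_I_smul_imaginaryPart x]
  rw [map_add, map_smul]
  refine (norm_add_le _ _).trans (add_le_add ?_ ?_)
  · exact (hsa _).trans (realPart.norm_le x)
  · rw [norm_smul, Complex.norm_I, one_mul]
    exact (hsa _).trans (imaginaryPart.norm_le x)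

/-- A closed ideal is separated from each element outside it by a state vanishing on the ideal. -/
theorem TwoSidedIdeal.exists_annihilatingStates_ne_zero {J : TwoSidedIdeal U}
    (hJ : IsClosed (J : Set U)) {b : U} (hb : b ∉ J) :
    ∃ F ∈ J.annihilatingStates, F (star b * b) ≠ 0 := by
  obtain ⟨t, ht, h⟩ : ∃ t : ℝ, 0 < t ∧
      ∀ j ∈ J, IsSelfAdjoint j → ¬ star b * b ≤ algebraMap ℝ U t + j := by
    by_contra! hcon
    exact hb (mem_of_forall_star_mul_self_le hJ hcon)
  let C₀ : PointedCone ℝ (selfAdjoint U) :=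
    { carrier := {x | ∃ j ∈ J, IsSelfAdjoint j ∧ j ≤ (x : U)}
      zero_mem' := ⟨0, J.zero_mem, .zero U, le_rfl⟩
      add_mem' := by
        rintro x y ⟨i, hi, hi', hix⟩ ⟨j, hj, hj', hjy⟩
        exact ⟨i + j, J.add_mem hi hj, hi'.add hj', add_le_add hix hjy⟩
      smul_mem' := by
        rintro ⟨c, hc⟩ x ⟨j, hj, hj', hjx⟩
        refine ⟨c • j, ?_, IsSelfAdjoint.smul (.all c) hj', smul_le_smul_of_nonneg_left hjx hc⟩
        rw [Algebra.smul_def]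
        exact J.mul_mem_left _ _ hj }
  let C : ProperCone ℝ (selfAdjoint U) := Submodule.closure C₀
  have hC₀ : ∀ x : selfAdjoint U, (∃ j ∈ J, IsSelfAdjoint j ∧ j ≤ (x : U)) → x ∈ C :=
    fun x hx => subset_closure (show x ∈ (C₀ : Set (selfAdjoint U)) from hx)
  let a : selfAdjoint U := ⟨star b * b, .star_mul_self b⟩
  have ha : -a ∉ C := by
    intro hmem
    obtain ⟨x, ⟨j, hj, hj', hjx⟩, hx⟩ := Metric.mem_closure_iff.1
      (show -a ∈ closure (C₀ : Set (selfAdjoint U)) from hmem) t ht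
    refine h (-j) (J.neg_mem hj) hj'.neg ?_
    have h1 : ((a + x : selfAdjoint U) : U) ≤ algebraMap ℝ U t := by
      refine ((a + x).2.le_algebraMap_norm_self).trans ?_
      refine algebraMap_mono U ?_
      rw [dist_eq_norm, ← norm_neg, neg_sub, sub_neg_eq_add, add_comm] at hx
      exact hx.le
    have h2 : star b * b + x ≤ algebraMap ℝ U t := h1
    rw [← sub_eq_add_neg, le_sub_iff_add_le]
    exact (add_le_add_right hjx _).trans h2
  obtain ⟨f, hf, hfa⟩ := C.hyperplane_separation_point ha
  have hfpos : ∀ x : selfAdjoint U, 0 ≤ (x : U) → 0 ≤ f x := fun x hx =>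
    hf x (hC₀ x ⟨0, J.zero_mem, .zero U, hx⟩)
  have hfJ : ∀ x : selfAdjoint U, (x : U) ∈ J → f x = 0 := fun x hx => by
    refine le_antisymm ?_ (hf x (hC₀ x ⟨x, hx, x.2, le_rfl⟩))
    have := hf (-x) (hC₀ (-x) ⟨-x, J.neg_mem hx, (-x).2, le_rfl⟩)
    rw [map_neg] at this
    linarith
  rw [map_neg, neg_lt_zero] at hfa
  have hf1 : 0 < f 1 := by
    have : 0 ≤ f (‖star b * b‖ • 1 - a) := hfpos _ <| by
      have := (IsSelfAdjoint.star_mul_self b).le_algebraMap_norm_self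
      rw [Algebra.algebraMap_eq_smul_one] at this
      simpa [a] using this
    rw [map_sub, map_smul, smul_eq_mul, sub_nonneg] at this
    exact pos_of_mul_pos_right (hfa.trans_le this) (norm_nonneg _)
  let φ : U →ₗ[ℂ] ℂ :=
    { toFun x := ((f 1)⁻¹ : ℝ) * (f (ℜ x) + Complex.I * f (ℑ x))
      map_add' x y := by
        simp only [map_add, Complex.ofReal_add]; ring
      map_smul' c x := by
        apply Complex.ext <;> simp [realPart_smul, imaginaryPart_smul] <;> ring }
  have hφsa : ∀ x : selfAdjoint U, φ x = ((f 1)⁻¹ * f x : ℝ) := fun x => by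
    simp [φ]
  refine ⟨φ, ⟨φ, rfl, fun p hp => ?_, ?_, fun j hj => ?_⟩, ?_⟩
  · have := hφsa ⟨p, hp.isSelfAdjoint⟩
    rw [this]
    have := hfpos ⟨p, hp.isSelfAdjoint⟩ hp
    exact_mod_cast (by positivity : 0 ≤ (f 1)⁻¹ * f ⟨p, hp.isSelfAdjoint⟩)
  · have := hφsa 1
    rw [inv_mul_cancel₀ hf1.ne'] at this
    simpa using this
  · have hmem : ∀ {x : U} (c : ℂ), x ∈ J → c • x ∈ J := fun {x} c hx => by
      rw [Algebra.smul_def]; exact J.mul_mem_left _ _ hx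
    have hs := star_mem_of_isClosed hJ hj
    have h1 : ((ℜ j : selfAdjoint U) : U) ∈ J := by
      rw [realPart_apply_coe, ← Complex.coe_smul]
      exact hmem _ (J.add_mem hj hs)
    have h2 : ((ℑ j : selfAdjoint U) : U) ∈ J := by
      rw [imaginaryPart_apply_coe, ← Complex.coe_smul (2⁻¹ : ℝ)]
      exact hmem _ (hmem _ (J.sub_mem hj hs))
    simp [φ, hfJ _ h1, hfJ _ h2]
  · rw [show star b * b = (a : U) from rfl, hφsa]
    exact_mod_cast (by positivity : (f 1)⁻¹ * f a ≠ 0)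

theorem TwoSidedIdeal.exists_extreme_annihilatingStates_ne_zero {J : TwoSidedIdeal U}
    (hJ : IsClosed (J : Set U)) {b : U} (hb : b ∉ J) :
    ∃ F ∈ J.annihilatingStates.extremePoints ℝ, F (star b * b) ≠ 0 := by
  obtain ⟨F₀, hF₀, hne⟩ := exists_annihilatingStates_ne_zero hJ hb
  let l : StrongDual ℝ (U → ℂ) :=
    Complex.reCLM ∘L ContinuousLinearMap.proj (R := ℝ) (φ := fun _ : U => ℂ) (star b * b)
  have hl : 0 < l F₀ := by
    obtain ⟨φ, rfl, hpos, -, -⟩ := hF₀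
    exact (Complex.lt_def.1 ((hpos _ (star_mul_self_nonneg b)).lt_of_ne' hne)).1
  have hexp : IsExposed ℝ J.annihilatingStates
      {F ∈ J.annihilatingStates | ∀ G ∈ J.annihilatingStates, l G ≤ l F} := fun _ => ⟨l, rfl⟩
  obtain ⟨G, hG, hmax⟩ := J.isCompact_annihilatingStates.exists_isMaxOn ⟨F₀, hF₀⟩
    l.continuous.continuousOn
  obtain ⟨F, hF⟩ :=
    (hexp.isCompact J.isCompact_annihilatingStates).extremePoints_nonempty ⟨G, hG, hmax⟩
  refine ⟨F, hexp.isExtreme.extremePoints_subset_extremePoints hF, fun h => ?_⟩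
  have hle := hl.trans_le (hF.1.2 F₀ hF₀)
  have : l F = (F (star b * b)).re := rfl
  rw [this, h, Complex.zero_re] at hle
  exact lt_irrefl _ hle

/-- The GNS representation of an extreme point of the states vanishing on an ideal has no
nontrivial closed invariant subspaces. -/
theorem TwoSidedIdeal.gns_eq_bot_or_top {J : TwoSidedIdeal U} {φ : U →ₚ[ℂ] ℂ}
    (hφ : ⇑φ ∈ J.annihilatingStates.extremePoints ℝ) (K : Submodule ℂ φ.GNS)
    (hK : IsClosed (K : Set φ.GNS)) (hinv : ∀ a, ∀ x ∈ K, φ.gnsStarAlgHom a x ∈ K) :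
    K = ⊥ ∨ K = ⊤ := by
  have : CompleteSpace K := hK.completeSpace_coe
  set P := K.starProjection with hP
  set π := φ.gnsStarAlgHom with hπ
  have hadj : ∀ a x y, inner ℂ (π a x) y = inner ℂ x (π (star a) y) := fun a x y => by
    rw [map_star, ContinuousLinearMap.star_eq_adjoint, ContinuousLinearMap.adjoint_inner_right]
  have hcomm : ∀ a x, P (π a x) = π a (P x) := fun a x => by
    refine Submodule.eq_starProjection_of_mem_of_inner_eq_zero
      (hinv a _ (Submodule.starProjection_apply_mem _ _)) fun w hw => ?_
    rw [← map_sub, hadj]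
    exact Submodule.starProjection_inner_eq_zero _ _ (hinv _ _ hw)
  let e : U →ₗ[ℂ] φ.GNS :=
    (UniformSpace.Completion.toComplL (𝕜 := ℂ) (E := φ.PreGNS)).toLinearMap ∘ₗ
      φ.toPreGNS.toLinearMap
  have he : ∀ a b, π a (e b) = e (a * b) := fun a b => by
    change φ.gnsNonUnitalStarAlgHom a ((φ.toPreGNS b : φ.PreGNS) : φ.GNS) = _
    rw [PositiveLinearMap.gnsNonUnitalStarAlgHom_apply_coe]
    rfl
  have hinner : ∀ a b, inner ℂ (e a) (e b) = φ (star a * b) := fun a b =>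
    UniformSpace.Completion.inner_coe _ _
  have hPe : ∀ a b, inner ℂ (e a) (P (e b)) = inner ℂ (e 1) (P (e (star a * b))) := fun a b => by
    rw [← he (star a) b, hcomm, ← hadj, he, mul_one]
  have hPsq : ∀ y, inner ℂ (e 1) (P (e (star y * y))) = ((‖P (e y)‖ ^ 2 : ℝ) : ℂ) := fun y => by
    rw [← hPe]
    have : P (P (e y)) = P (e y) :=
      Submodule.starProjection_eq_self_iff.2 (Submodule.starProjection_apply_mem _ _)
    rw [← this, ← Submodule.inner_starProjection_left_eq_right, inner_self_eq_norm_sq_to_K, this]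
    push_cast
    rfl
  have hφsq : ∀ y, φ (star y * y) = ((‖e y‖ ^ 2 : ℝ) : ℂ) := fun y => by
    rw [← hinner, inner_self_eq_norm_sq_to_K]
    simp
  obtain ⟨φ', hφ', -, h1, h0⟩ := hφ.1
  rw [hφ'] at h1 h0
  set t : ℝ := ‖P (e 1)‖ ^ 2 with ht
  have he1 : ‖e 1‖ ^ 2 = 1 := by
    have := hφsq 1
    rw [star_one, one_mul, h1] at this
    exact_mod_cast this.symm
  have ht0 : 0 ≤ t := by positivity
  have ht1 : t ≤ 1 := by
    rw [← he1]
    exact pow_le_pow_left₀ (norm_nonneg _) (Submodule.norm_starProjection_apply_le _ _) 2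
  let D : U →ₗ[ℂ] ℂ :=
    (innerSL ℂ (e 1)).toLinearMap ∘ₗ P.toLinearMap ∘ₗ e - (t : ℂ) • φ.toLinearMap
  have hDapp : ∀ x, D x = inner ℂ (e 1) (P (e x)) - t * φ x := fun x => rfl
  have hDsq : ∀ y, D (star y * y) = ((‖P (e y)‖ ^ 2 - t * ‖e y‖ ^ 2 : ℝ) : ℂ) := fun y => by
    rw [hDapp, hPsq, hφsq]
    push_cast
    rfl
  have hnorm : ∀ y, ‖P (e y)‖ ^ 2 ≤ ‖e y‖ ^ 2 := fun y => by
    exact pow_le_pow_left₀ (norm_nonneg _) (Submodule.norm_starProjection_apply_le _ _) 2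
  have hD : D = 0 := by
    refine eq_zero_of_extreme_annihilatingStates (φ := φ.toLinearMap) hφ ?_ ?_ ?_ ?_
    · have := hDsq 1
      rw [star_one, one_mul, he1, mul_one, ← ht, sub_self] at this
      simpa using this
    · intro p hp
      obtain ⟨y, rfl⟩ := CStarAlgebra.nonneg_iff_eq_star_mul_self.1 hp
      change 0 ≤ φ (star y * y) + _
      rw [hDsq, hφsq, ← Complex.ofReal_add, Complex.zero_le_real]
      nlinarith [sq_nonneg ‖P (e y)‖, mul_nonneg (sub_nonneg.2 ht1) (sq_nonneg ‖e y‖)]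
    · intro p hp
      obtain ⟨y, rfl⟩ := CStarAlgebra.nonneg_iff_eq_star_mul_self.1 hp
      change 0 ≤ φ (star y * y) - _
      rw [hDsq, hφsq, ← Complex.ofReal_sub, Complex.zero_le_real]
      nlinarith [hnorm y, mul_nonneg ht0 (sq_nonneg ‖e y‖)]
    · intro j hj
      have : e j = 0 := by
        have := hφsq j
        rw [h0 _ (J.mul_mem_left _ _ hj)] at this
        have h2 : ‖e j‖ ^ 2 = 0 := by exact_mod_cast this.symm
        simpa using h2
      rw [hDapp, this, h0 j hj]
      simp
  have hrange : DenseRange e := UniformSpace.Completion.denseRange_coe (α := φ.PreGNS)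
  have hPt : ∀ v, P v = (t : ℂ) • v := by
    have hPte : ∀ x, P (e x) = (t : ℂ) • e x := fun x => by
      refine hrange.eq_of_inner_right ℂ fun y => ?_
      rw [hPe, inner_smul_right, hinner, ← sub_eq_zero, ← hDapp, hD, LinearMap.zero_apply]
    exact fun v => congrFun (hrange.equalizer P.continuous (continuous_const_smul (t : ℂ))
      (funext hPte)) v
  by_cases h : (t : ℂ) = 1
  · right
    refine eq_top_iff.2 fun v _ => ?_
    have := hPt v
    rw [h, one_smul] at this
    exact Submodule.starProjection_eq_self_iff.1 this
  · left
    refine eq_bot_iff.2 fun v hv => ?_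
    have h2 := hPt v
    rw [hP, Submodule.starProjection_eq_self_iff.2 hv] at h2
    have h3 : (1 - (t : ℂ)) • v = 0 := by rw [sub_smul, one_smul, ← h2, sub_self]
    exact (smul_eq_zero.1 h3).resolve_left (sub_ne_zero.2 (Ne.symm h))

/-- A closed two-sided ideal is separated from each element outside it by an irreducible
representation. -/
theorem TwoSidedIdeal.exists_irreducible_of_notMem {J : TwoSidedIdeal U}
    (hJ : IsClosed (J : Set U)) {b : U} (hb : b ∉ J) :
    ∃ φ : U →ₚ[ℂ] ℂ, (∀ K : Submodule ℂ φ.GNS, IsClosed (K : Set φ.GNS) →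
      (∀ a, ∀ x ∈ K, φ.gnsStarAlgHom a x ∈ K) → K = ⊥ ∨ K = ⊤) ∧
      (∀ j ∈ J, φ.gnsStarAlgHom j = 0) ∧ φ.gnsStarAlgHom b ≠ 0 := by
  obtain ⟨F, hF, hFb⟩ := exists_extreme_annihilatingStates_ne_zero hJ hb
  obtain ⟨φ₀, rfl, hpos, -, h0⟩ := hF.1
  set φ : U →ₚ[ℂ] ℂ := PositiveLinearMap.mk₀ φ₀ hpos with hφ
  have happ : ∀ x, φ x = φ₀ x := fun x => rfl
  have hpre : ∀ a x : U, ‖φ.gnsStarAlgHom a (φ.toPreGNS x : φ.PreGNS)‖ ^ 2 =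
      φ (star (a * x) * (a * x)) := fun a x => by
    change (‖φ.gnsNonUnitalStarAlgHom a (φ.toPreGNS x : φ.PreGNS)‖ : ℂ) ^ 2 = _
    rw [PositiveLinearMap.gnsNonUnitalStarAlgHom_apply_coe, UniformSpace.Completion.norm_coe]
    exact φ.preGNS_norm_sq _
  refine ⟨φ, gns_eq_bot_or_top (φ := φ) hF, fun j hj => ?_, fun h => hFb ?_⟩
  · ext v
    refine congrFun (UniformSpace.Completion.denseRange_coe.equalizer
      (φ.gnsStarAlgHom j).continuous (h := fun _ => (0 : φ.GNS)) continuous_const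
      (funext fun x => ?_)) v
    have := hpre j (φ.ofPreGNS x)
    rw [happ, h0 _ (J.mul_mem_left _ _ (J.mul_mem_right _ _ hj)), φ.toPreGNS_ofPreGNS] at this
    have hnorm : ‖φ.gnsStarAlgHom j (x : φ.GNS)‖ ^ 2 = 0 := by exact_mod_cast this
    exact norm_eq_zero.1 ((pow_eq_zero_iff two_ne_zero).1 hnorm)
  · have := hpre b 1
    rw [h, mul_one, happ] at this
    simpa using this.symm

end UnitalCStarAlgebra

section NonUnitalCStarAlgebra

variable {B : Type u} [NonUnitalCStarAlgebra B]

theorem TwoSidedIdeal.smul_mem_of_isClosed {I : TwoSidedIdeal B} (hI : IsClosed (I : Set B))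
    (c : ℂ) {x : B} (hx : x ∈ I) : c • x ∈ I := by
  let _ : PartialOrder B := CStarAlgebra.spectralOrder B
  have _ : StarOrderedRing B := CStarAlgebra.spectralOrderedRing B
  have h := CStarAlgebra.increasingApproximateUnit B
  have := h.neBot
  refine hI.mem_of_tendsto ((h.tendsto_mul_right x).const_smul c) (.of_forall fun e => ?_)
  rw [← smul_mul_assoc]
  exact I.mul_mem_left _ _ hx

theorem TwoSidedIdeal.exists_mem_starStructureSpace {I : TwoSidedIdeal B}
    (hI : IsClosed (I : Set B)) {b : B} (hb : b ∉ I) :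
    ∃ P ∈ starStructureSpace B, (I : Set B) ⊆ P ∧ b ∉ P := by
  let _ : PartialOrder (Unitization ℂ B) := CStarAlgebra.spectralOrder _
  have _ : StarOrderedRing (Unitization ℂ B) := CStarAlgebra.spectralOrderedRing _
  let J : TwoSidedIdeal (Unitization ℂ B) :=
    .mk' ((↑) '' (I : Set B)) ⟨0, I.zero_mem, Unitization.inr_zero ℂ⟩
      (by
        rintro _ _ ⟨x, hx, rfl⟩ ⟨y, hy, rfl⟩
        exact ⟨x + y, I.add_mem hx hy, Unitization.inr_add ℂ x y⟩)
      (by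
        rintro _ ⟨x, hx, rfl⟩
        exact ⟨-x, I.neg_mem hx, Unitization.inr_neg ℂ x⟩)
      (by
        rintro u _ ⟨y, hy, rfl⟩
        induction u with
        | inl_add_inr c x =>
          refine ⟨c • y + x * y, I.add_mem (smul_mem_of_isClosed hI c hy)
            (I.mul_mem_left _ _ hy), ?_⟩
          rw [add_mul, Unitization.inl_mul_inr, ← Unitization.inr_mul, ← Unitization.inr_add])
      (by
        rintro _ u ⟨y, hy, rfl⟩
        induction u with
        | inl_add_inr c x =>
          refine ⟨c • y + y * x, I.add_mem (smul_mem_of_isClosed hI c hy)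
            (I.mul_mem_right _ _ hy), ?_⟩
          rw [mul_add, Unitization.inr_mul_inl, ← Unitization.inr_mul, ← Unitization.inr_add])
  have hmem : ∀ u, u ∈ J ↔ u ∈ ((↑) '' (I : Set B) : Set (Unitization ℂ B)) :=
    fun u => TwoSidedIdeal.mem_mk' ..
  have hJ : IsClosed (J : Set (Unitization ℂ B)) := by
    have : (J : Set (Unitization ℂ B)) = (↑) '' (I : Set B) := Set.ext hmem
    rw [this]
    exact (Unitization.isometry_inr (𝕜 := ℂ) (A := B)).isClosedEmbedding.isClosedMap _ hI
  have hbJ : (b : Unitization ℂ B) ∉ J := fun h => by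
    obtain ⟨x, hx, hxb⟩ := (hmem _).1 h
    exact hb (Unitization.inr_injective hxb ▸ hx)
  obtain ⟨φ, hirr, hzero, hne⟩ := exists_irreducible_of_notMem hJ hbJ
  let ρ : StarRep B :=
    { H := φ.GNS
      π := (φ.gnsStarAlgHom : Unitization ℂ B →⋆ₙₐ[ℂ] (φ.GNS →L[ℂ] φ.GNS)).comp
        (Unitization.inrNonUnitalStarAlgHom ℂ B) }
  have hρ : ∀ x, ρ.π x = φ.gnsStarAlgHom (x : Unitization ℂ B) := fun x => rfl
  refine ⟨_, ⟨ρ, ⟨⟨b, hne⟩, fun K hK hinv => hirr K hK fun u x hx => ?_⟩, rfl⟩,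
    fun i hi => hzero _ ((hmem _).2 ⟨i, hi, rfl⟩), hne⟩
  induction u with
  | inl_add_inr c y =>
    rw [map_add, add_apply]
    refine K.add_mem ?_ (hinv y x hx)
    rw [← Unitization.algebraMap_eq_inl, AlgHomClass.commutes, Algebra.algebraMap_eq_smul_one]
    exact K.smul_mem c hx

theorem exists_mem_starStructureSpace_of_ne_zero {b : B} (hb : b ≠ 0) :
    ∃ P ∈ starStructureSpace B, b ∉ P := by
  obtain ⟨P, hP, -, hbP⟩ := TwoSidedIdeal.exists_mem_starStructureSpace (I := ⊥) (b := b)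
    (by rw [TwoSidedIdeal.coe_bot]; exact isClosed_singleton)
    (by rwa [TwoSidedIdeal.mem_bot])
  exact ⟨P, hP, hbP⟩

theorem StarRep.continuous (ρ : StarRep B) : Continuous ρ.π :=
  AddMonoidHomClass.continuous_of_bound ρ.π 1 fun b => by
    simpa using NonUnitalStarAlgHom.norm_apply_le ρ.π b

/-- The kernel of a set of primitive ideals is a closed two-sided ideal. -/
theorem exists_twoSidedIdeal_coe_eq_sInter {Y : Set (Set B)} (hY : Y ⊆ starStructureSpace B) :
    ∃ I : TwoSidedIdeal B, IsClosed (I : Set B) ∧ (I : Set B) = ⋂₀ Y := by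
  have key : (⋂₀ Y = {b | ∀ ρ : StarRep B, {a : B | ρ.π a = 0} ∈ Y → ρ.π b = 0}) := by
    ext b
    constructor
    · exact fun hb ρ hρ => hb _ hρ
    · intro hb P hP
      obtain ⟨ρ, -, rfl⟩ := hY hP
      exact hb ρ hP
  let I : TwoSidedIdeal B := .mk' {b | ∀ ρ : StarRep B, {a : B | ρ.π a = 0} ∈ Y → ρ.π b = 0}
    (fun ρ _ => map_zero _)
    (fun hx hy ρ hρ => by rw [map_add, hx ρ hρ, hy ρ hρ, add_zero])
    (fun hx ρ hρ => by rw [map_neg, hx ρ hρ, neg_zero])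
    (fun hy ρ hρ => by rw [map_mul, hy ρ hρ, mul_zero])
    (fun hx ρ hρ => by rw [map_mul, hx ρ hρ, zero_mul])
  have hI : (I : Set B) = ⋂₀ Y := by
    rw [key]
    exact Set.ext fun u => TwoSidedIdeal.mem_mk' ..
  refine ⟨I, ?_, hI⟩
  rw [hI]
  refine isClosed_sInter fun P hP => ?_
  obtain ⟨ρ, -, rfl⟩ := hY hP
  exact isClosed_eq ρ.continuous continuous_const

theorem zero_mem_of_mem_starStructureSpace {P : Set B} (hP : P ∈ starStructureSpace B) :
    (0 : B) ∈ P := by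
  obtain ⟨ρ, -, rfl⟩ := hP
  exact map_zero ρ.π

theorem preimage_mem_starStructureSpace {D : NonUnitalStarSubalgebra ℂ B}
    (hD : Dense (D : Set B)) {P : Set B} (hP : P ∈ starStructureSpace B) :
    (Subtype.val ⁻¹' P : Set D) ∈ starStructureSpace D := by
  obtain ⟨ρ, ⟨⟨b, hb⟩, hirr⟩, rfl⟩ := hP
  let σ : StarRep D :=
    { H := ρ.H
      π := ρ.π.comp (NonUnitalStarSubalgebraClass.subtype D) }
  have hcont := ρ.continuous
  refine ⟨σ, ⟨?_, fun K hK hinv => hirr K hK fun a x hx => ?_⟩, rfl⟩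
  · by_contra! h
    have : Set.EqOn ρ.π (fun _ => 0) D := fun a ha => h ⟨a, ha⟩
    exact hb (congrFun (hcont.ext_on hD continuous_const this) b)
  · have hclosed : IsClosed {a : B | ρ.π a x ∈ K} :=
      hK.preimage (hcont.clm_apply continuous_const)
    exact hclosed.closure_subset_iff.2 (fun a ha => hinv ⟨a, ha⟩ x hx) (hD a)

end NonUnitalCStarAlgebra

/-- For a dense `*`-subalgebra `A` of a C*-algebra `B` and the canonical map
`Ψ : Π_B → Π*_A`, `Ψ(P) = P ∩ A`, the following are equivalent:
(1) the inclusion `A ⊆ B` has the ideal intersection property;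
(2) a subset `Y ⊆ Π_B` is dense in `Π_B` if (and only if) `Ψ(Y)` is dense in the range
    of `Ψ`;
(3) for every proper hull-kernel closed subset `K ⊆ Π_B` there is a nonzero `f ∈ A` with
    `f ∈ k_B(K)`. -/
theorem charIIP_dense {B : Type u} [NonUnitalCStarAlgebra B]
    (A : NonUnitalStarSubalgebra ℂ B) (hA : Dense (A : Set B)) :
    List.TFAE
      [ DetIdeals (A : Set B),
        ∀ Y ⊆ starStructureSpace B,
          (hkClosure B Y = starStructureSpace B ↔
            (fun Q : Set B => (Subtype.val ⁻¹' Q : Set ↥A)) '' starStructureSpace B ⊆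
              hkClosure ↥A ((fun Q : Set B => (Subtype.val ⁻¹' Q : Set ↥A)) '' Y)),
        ∀ K, IsHKClosed B K → K ≠ starStructureSpace B →
          ∃ f : B, f ≠ 0 ∧ f ∈ (A : Set B) ∧ f ∈ ⋂₀ K ] := by
  have zero_inter (I : TwoSidedIdeal B) : {0} ⊆ (I : Set B) ∩ A :=
    Set.singleton_subset_iff.2 ⟨I.zero_mem, A.zero_mem⟩
  tfae_have 1 → 2 := by
    intro h Y hY
    constructor
    · rintro hdense _ ⟨P, hP, rfl⟩
      refine ⟨preimage_mem_starStructureSpace hA hP, fun a ha => ?_⟩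
      rw [← hdense] at hP
      exact hP.2 fun Q hQ => ha _ ⟨Q, hQ, rfl⟩
    · intro hdense
      obtain ⟨I, hI, hIY⟩ := exists_twoSidedIdeal_coe_eq_sInter hY
      have hbot : I = ⊥ := by
        by_contra hne
        refine h I hI hne (Set.Subset.antisymm ?_ (zero_inter I))
        rintro a ⟨haI, haA⟩
        by_contra ha
        obtain ⟨P, hP, haP⟩ := exists_mem_starStructureSpace_of_ne_zero ha
        have hsub := (hdense ⟨P, hP, rfl⟩).2
        refine haP (show (⟨a, haA⟩ : A) ∈ Subtype.val ⁻¹' P from hsub ?_)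
        rintro _ ⟨Q, hQ, rfl⟩
        rw [hIY] at haI
        exact haI Q hQ
      refine Set.Subset.antisymm (fun P hP => hP.1) fun P hP => ⟨hP, ?_⟩
      rw [← hIY, hbot, TwoSidedIdeal.coe_bot, Set.singleton_subset_iff]
      exact zero_mem_of_mem_starStructureSpace hP
  tfae_have 2 → 3 := by
    rintro h K ⟨hK, hclosed⟩ hne
    by_contra! hcon
    refine hne (hclosed.trans ((h K hK).2 ?_))
    rintro _ ⟨P, hP, rfl⟩
    refine ⟨preimage_mem_starStructureSpace hA hP, fun a ha => ?_⟩
    have ha0 : (a : B) = 0 := by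
      by_contra ha0
      exact hcon a ha0 a.2 fun Q hQ => ha _ ⟨Q, hQ, rfl⟩
    rw [Set.mem_preimage, ha0]
    exact zero_mem_of_mem_starStructureSpace hP
  tfae_have 3 → 1 := by
    intro h I hI hne hinter
    have hsub : (I : Set B) ⊆ ⋂₀ hkHull B I := fun x hx P hP => hP.2 hx
    obtain ⟨f, hf0, hfA, hf⟩ := h (hkHull B I)
      ⟨fun P hP => hP.1, Set.Subset.antisymm (fun P hP => ⟨hP.1, fun x hx => hx P hP⟩)
        fun P hP => ⟨hP.1, hsub.trans hP.2⟩⟩ fun heq => hne <| by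
          refine (eq_bot_iff (a := I)).2 fun x hx => ?_
          rw [TwoSidedIdeal.mem_bot]
          by_contra hx0
          obtain ⟨P, hP, hxP⟩ := exists_mem_starStructureSpace_of_ne_zero hx0
          rw [← heq] at hP
          exact hxP (hP.2 hx)
    have hfI : f ∈ I := by
      by_contra hfI
      obtain ⟨P, hP, hIP, hfP⟩ := TwoSidedIdeal.exists_mem_starStructureSpace hI hfI
      exact hfP (hf P ⟨hP, hIP⟩)
    exact hf0 (hinter.subset ⟨hfI, hfA⟩)
  tfae_finish
end

section
/- Let A ⊆ B be an inclusion of a dense *-subalgebra into a C*-algebra B, let R_A^B denote the set of *-representations of A that extend to *-representations of B, and for π ∈ R_A^B let π̄ denote its extension to B. Then: (1) the inclusion A ⊆ B has the ideal separation property if and only if for every π, ϱ ∈ R_A^B, the containment ker(π) ⊆ ker(ϱ) in A implies ‖ϱ̄(b)‖ ≤ ‖π̄(b)‖ for all b ∈ B; (2) the inclusion A ⊆ B has the ideal intersection property if and only if for every π ∈ R_A^B, ker(π) = {0} in A implies ‖π̄(b)‖ = ‖b‖_B for all b ∈ B. -/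
universe u

protected theorem NonUnitalStarAlgHom.continuous {B C : Type*} [NonUnitalCStarAlgebra B]
    [NonUnitalCStarAlgebra C] (φ : B →⋆ₙₐ[ℂ] C) : Continuous φ :=
  AddMonoidHomClass.continuous_of_bound φ 1 fun x ↦ by
    simpa using NonUnitalStarAlgHom.norm_apply_le φ x

theorem NonUnitalStarAlgHom.norm_le_of_ker_le {B C D : Type*} [NonUnitalCStarAlgebra B]
    [NonUnitalCStarAlgebra C] [NonUnitalCStarAlgebra D]
    (φ : B →⋆ₙₐ[ℂ] C) (ψ : B →⋆ₙₐ[ℂ] D) (h : ∀ b, φ b = 0 → ψ b = 0) (b : B) :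
    ‖ψ b‖ ≤ ‖φ b‖ := by
  set a : B := star b * b with ha
  have hsa : IsSelfAdjoint a := .star_mul_self b
  set r : ℝ := ‖φ a‖
  have hr : 0 ≤ r := norm_nonneg _
  set g : ℝ → ℝ := fun t ↦ max (-r) (min r t) with hg
  have hgc : Continuous g := by fun_prop
  have hg0 : g 0 = 0 := by simp [hg, hr]
  have hsφ : IsSelfAdjoint (φ a) := hsa.map φ
  have hφg : φ (cfcₙ g a) = φ a := by
    rw [φ.map_cfcₙ g a hgc.continuousOn hg0 φ.continuous hsa hsφ]
    conv_rhs => rw [← cfcₙ_id ℝ (φ a) hsφ]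
    refine cfcₙ_congr fun t ht ↦ ?_
    have ht' : ‖t‖ ≤ r := by
      simpa [cfcₙ_id ℝ (φ a) hsφ] using norm_apply_le_norm_cfcₙ (id : ℝ → ℝ) (φ a) ht
    have := abs_le.mp ht'
    simp [hg, this.1, this.2]
  have hψg : ψ (cfcₙ g a) = ψ a := by
    have := h (cfcₙ g a - a) (by rw [map_sub, hφg, sub_self])
    rwa [map_sub, sub_eq_zero] at this
  have key : ‖ψ a‖ ≤ ‖φ a‖ := by
    rw [← hψg]
    refine (NonUnitalStarAlgHom.norm_apply_le ψ _).trans (norm_cfcₙ_le fun t _ ↦ ?_)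
    rw [Real.norm_eq_abs, abs_le]
    exact ⟨le_max_left _ _, max_le (by linarith) (min_le_left _ _)⟩
  simp only [ha, map_mul, map_star, CStarRing.norm_star_mul_self] at key
  exact (mul_self_le_mul_self_iff (norm_nonneg _) (norm_nonneg _)).mpr key

section DirectSum

variable {B ι : Type*} [NonUnitalCStarAlgebra B] {H : ι → Type*} [∀ i, NormedAddCommGroup (H i)]
  [∀ i, InnerProductSpace ℂ (H i)] [∀ i, CompleteSpace (H i)]

open scoped ENNReal

theorem NonUnitalStarAlgHom.norm_apply_apply_le {K : Type*} [NormedAddCommGroup K]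
    [InnerProductSpace ℂ K] [CompleteSpace K] (φ : B →⋆ₙₐ[ℂ] (K →L[ℂ] K)) (b : B) (v : K) :
    ‖φ b v‖ ≤ ‖b‖ * ‖v‖ :=
  ((φ b).le_opNorm v).trans (by gcongr; exact NonUnitalStarAlgHom.norm_apply_le φ b)

/-- The operator on the `ℓ²` direct sum by which `b` acts in the direct sum of a family of
representations. -/
noncomputable def lp.diagRep (φ : ∀ i, B →⋆ₙₐ[ℂ] (H i →L[ℂ] H i)) (b : B) :
    lp H 2 →L[ℂ] lp H 2 :=
  have hle (v : lp H 2) (i : ι) : ‖φ i b (v i)‖ ≤ ‖((‖b‖ : ℂ) • v) i‖ := by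
    rw [lp.coeFn_smul, Pi.smul_apply, norm_smul, Complex.norm_real, norm_norm]
    exact (φ i).norm_apply_apply_le b (v i)
  LinearMap.mkContinuous
    { toFun v := ⟨fun i ↦ φ i b (v i), (lp.memℓp ((‖b‖ : ℂ) • v)).mono' (hle v)⟩
      map_add' v w := by ext i; exact map_add (φ i b) (v i) (w i)
      map_smul' c v := by ext i; exact map_smul (φ i b) c (v i) }
    ‖b‖ fun v ↦ (lp.norm_mono (by simp) (hle v)).trans (by
      rw [norm_smul, Complex.norm_real, norm_norm])

@[simp]
theorem lp.diagRep_apply (φ : ∀ i, B →⋆ₙₐ[ℂ] (H i →L[ℂ] H i)) (b : B) (v : lp H 2) (i : ι) :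
    lp.diagRep φ b v i = φ i b (v i) := rfl

/-- The `ℓ²` direct sum of a family of representations of a C⋆-algebra. -/
noncomputable def lp.directSumRep (φ : ∀ i, B →⋆ₙₐ[ℂ] (H i →L[ℂ] H i)) :
    B →⋆ₙₐ[ℂ] (lp H 2 →L[ℂ] lp H 2) where
  toFun := lp.diagRep φ
  map_smul' c b := by ext v i; simp
  map_zero' := by ext v i; simp
  map_add' a b := by ext v i; simp
  map_mul' a b := by ext v i; simp
  map_star' b := by
    refine (ContinuousLinearMap.eq_adjoint_iff _ _).mpr fun v w ↦ ?_
    rw [lp.inner_eq_tsum, lp.inner_eq_tsum]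
    refine tsum_congr fun i ↦ ?_
    simp [map_star, ContinuousLinearMap.star_eq_adjoint, ContinuousLinearMap.adjoint_inner_left]

theorem lp.directSumRep_eq_zero_iff (φ : ∀ i, B →⋆ₙₐ[ℂ] (H i →L[ℂ] H i)) (b : B) :
    lp.directSumRep φ b = 0 ↔ ∀ i, φ i b = 0 := by
  classical
  refine ⟨fun h i ↦ ?_, fun h ↦ ?_⟩
  · ext v
    have : lp.diagRep φ b (lp.single 2 i v) i = 0 := by
      rw [show lp.diagRep φ b = 0 from h]; simp
    simpa using this
  · ext v i
    change lp.diagRep φ b v i = 0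
    simp [h i]

end DirectSum

section Ideal

variable {B : Type*} [NonUnitalCStarAlgebra B]

open scoped ComplexOrder

open Unitization CStarAlgebra in
theorem TwoSidedIdeal.exists_norm_sub_mul_sq_le (I : TwoSidedIdeal B) {z b : B} (hz : z ∈ I)
    (hzs : IsSelfAdjoint z) {ε : ℝ} (hε : 0 < ε)
    (h : ((star b * b : B) : Unitization ℂ B) ≤ z + algebraMap ℝ _ ε) :
    ∃ a ∈ I, ‖b - b * a‖ ^ 2 ≤ 2 * ε := by
  set k : ℝ → ℝ := fun t ↦ t / (t ^ 2 + ε ^ 2) with hk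
  have hpos (t : ℝ) : 0 < t ^ 2 + ε ^ 2 := by positivity
  have hkc : Continuous k := by fun_prop (disch := exact fun t ↦ (hpos t).ne')
  refine ⟨z * cfcₙ k z, I.mul_mem_right _ _ hz, ?_⟩
  set w : Unitization ℂ B := (z : Unitization ℂ B) with hw
  have hws : IsSelfAdjoint w := hzs.inr ℂ
  set v : ℝ → ℝ := fun t ↦ 1 - t * k t with hv
  have hvc : Continuous v := by fun_prop
  have hu : ((b - b * (z * cfcₙ k z) : B) : Unitization ℂ B) = b * cfc v w := by
    rw [hv, cfc_sub (fun _ ↦ 1) _ w, cfc_const_one ℝ w,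
      cfc_mul (fun t ↦ t) k w (by fun_prop) hkc.continuousOn, cfc_id' ℝ w,
      ← real_cfcₙ_eq_cfc_inr z k (by simp [hk])]
    simp [mul_sub, hw]
  have hus : star (cfc v w) = cfc v w := (cfc_predicate v w : IsSelfAdjoint _).star_eq
  rw [← norm_inr (𝕜 := ℂ), hu, sq, ← CStarRing.norm_star_mul_self, star_mul, hus]
  have hle : cfc v w * star (b : Unitization ℂ B) * (b * cfc v w) ≤
      cfc v w * (w + algebraMap ℝ _ ε) * cfc v w := by
    have := star_left_conjugate_le_conjugate h (cfc v w)
    simpa [hus, mul_assoc] using this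
  have heq : cfc v w * (w + algebraMap ℝ _ ε) * cfc v w =
      cfc (fun t ↦ v t * (t + ε) * v t) w := by
    rw [cfc_mul _ v w, cfc_mul v _ w, cfc_add_const ε (fun t ↦ t) w, cfc_id' ℝ w]
  have hnn : 0 ≤ cfc v w * star (b : Unitization ℂ B) * (b * cfc v w) := by
    have := star_mul_self_nonneg ((b : Unitization ℂ B) * cfc v w)
    rwa [star_mul, hus] at this
  refine (norm_le_norm_of_nonneg_of_le hnn hle).trans ?_
  rw [heq]
  refine norm_cfc_le (by positivity) fun t _ ↦ ?_
  have hvt : v t = ε ^ 2 / (t ^ 2 + ε ^ 2) := by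
    simp only [hv, hk]; have := hpos t; field_simp; ring
  rw [hvt, Real.norm_eq_abs]
  rw [show ε ^ 2 / (t ^ 2 + ε ^ 2) * (t + ε) * (ε ^ 2 / (t ^ 2 + ε ^ 2)) =
    (t + ε) * ε ^ 4 / (t ^ 2 + ε ^ 2) ^ 2 by have := (hpos t).ne'; field_simp,
    abs_div, abs_mul, abs_of_pos (pow_pos hε 4), abs_of_pos (pow_pos (hpos t) 2),
    div_le_iff₀ (pow_pos (hpos t) 2)]
  have h1 : |t + ε| ≤ |t| + ε := (abs_add_le _ _).trans (by rw [abs_of_pos hε])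
  have h2 : (|t| + ε) * ε ≤ 2 * (t ^ 2 + ε ^ 2) := by
    nlinarith [sq_nonneg (|t| - ε), sq_abs t, sq_nonneg t]
  have h3 : ε ^ 2 * (t ^ 2 + ε ^ 2) ≤ (t ^ 2 + ε ^ 2) ^ 2 := by nlinarith [sq_nonneg t, hpos t]
  calc |t + ε| * ε ^ 4 ≤ ((|t| + ε) * ε) * (ε * ε ^ 2) := by nlinarith [pow_pos hε 4]
    _ ≤ (2 * (t ^ 2 + ε ^ 2)) * (ε * ε ^ 2) := by gcongr
    _ = 2 * ε * (ε ^ 2 * (t ^ 2 + ε ^ 2)) := by ring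
    _ ≤ _ := by gcongr

open Unitization CStarAlgebra in
theorem IsSelfAdjoint.inr_le_algebraMap {r : B} (hr : IsSelfAdjoint r) {ε : ℝ} (h : ‖r‖ ≤ ε) :
    (r : Unitization ℂ B) ≤ algebraMap ℝ _ ε := by
  refine ((hr.inr ℂ).le_algebraMap_norm_self).trans ?_
  rw [norm_inr]
  exact algebraMap_le_algebraMap.mpr h

open Unitization CStarAlgebra in
theorem mem_closure_range_mul_left (b : B) : b ∈ closure (Set.range (b * ·)) := by
  rw [Metric.mem_closure_iff]
  intro δ hδ
  obtain ⟨a, -, ha⟩ := (⊤ : TwoSidedIdeal B).exists_norm_sub_mul_sq_le (z := star b * b) (b := b)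
    trivial (.star_mul_self b) (ε := δ ^ 2 / 4) (by positivity)
    (le_add_of_nonneg_right (algebraMap_nonneg _ (by positivity)))
  refine ⟨b * a, ⟨a, rfl⟩, ?_⟩
  rw [dist_eq_norm]
  nlinarith [norm_nonneg (b - b * a)]

variable [PartialOrder B] [StarOrderedRing B]

/-- The cone of all sums of a nonnegative element and a self-adjoint element whose real multiples
all lie in `I`. -/
def TwoSidedIdeal.nonnegAddCone (I : TwoSidedIdeal B) : PointedCone ℝ B where
  carrier := {x | ∃ p z : B, 0 ≤ p ∧ IsSelfAdjoint z ∧ (∀ s : ℝ, s • z ∈ I) ∧ x = p + z}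
  zero_mem' := ⟨0, 0, by simp [I.zero_mem]⟩
  add_mem' := by
    rintro _ _ ⟨p, z, hp, hz, hzI, rfl⟩ ⟨q, w, hq, hw, hwI, rfl⟩
    refine ⟨p + q, z + w, add_nonneg hp hq, hz.add hw, fun s ↦ ?_, by abel⟩
    rw [smul_add]
    exact I.add_mem (hzI s) (hwI s)
  smul_mem' := by
    rintro ⟨c, hc⟩ _ ⟨p, z, hp, hz, hzI, rfl⟩
    refine ⟨c • p, c • z, smul_nonneg hc hp, (IsSelfAdjoint.all c).smul hz, fun s ↦ ?_, ?_⟩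
    · rw [smul_smul]; exact hzI _
    · exact smul_add c p z

open Unitization CStarAlgebra in
theorem TwoSidedIdeal.neg_star_mul_self_notMem_closure (I : TwoSidedIdeal B)
    (hI : IsClosed (I : Set B)) {b : B} (hb : b ∉ I) :
    -(star b * b) ∉ closure (I.nonnegAddCone : Set B) := by
  intro hmem
  apply hb
  change b ∈ (I : Set B)
  rw [← hI.closure_eq, Metric.mem_closure_iff]
  intro δ hδ
  obtain ⟨_, ⟨p, z, hp, hz, hzI, rfl⟩, hx⟩ :=
    Metric.mem_closure_iff.mp hmem (δ ^ 2 / 4) (by positivity)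
  have hbs : IsSelfAdjoint (star b * b) := .star_mul_self b
  have hps : IsSelfAdjoint p := .of_nonneg hp
  have hr : IsSelfAdjoint (star b * b + (p + z)) := hbs.add (hps.add hz)
  have hnorm : ‖star b * b + (p + z)‖ ≤ δ ^ 2 / 4 := by
    rw [show star b * b + (p + z) = -(-(star b * b) - (p + z)) by abel, norm_neg, ← dist_eq_norm]
    exact hx.le
  have hle : ((star b * b : B) : Unitization ℂ B) ≤
      ((-z : B) : Unitization ℂ B) + algebraMap ℝ _ (δ ^ 2 / 4) := by
    have h1 := hr.inr_le_algebraMap hnorm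
    have h2 : (0 : Unitization ℂ B) ≤ p := inr_nonneg_iff.mpr hp
    rw [inr_add, inr_add] at h1
    rw [inr_neg, neg_add_eq_sub, le_sub_iff_add_le]
    refine le_trans ?_ h1
    gcongr
    exact le_add_of_nonneg_left h2
  obtain ⟨a, ha, hab⟩ := I.exists_norm_sub_mul_sq_le (by simpa using hzI (-1)) hz.neg
    (by positivity) hle
  refine ⟨b * a, I.mul_mem_left _ _ ha, ?_⟩
  rw [dist_eq_norm]
  nlinarith [norm_nonneg (b - b * a)]

open ComplexStarModule in
theorem TwoSidedIdeal.exists_positiveLinearMap (I : TwoSidedIdeal B)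
    (hI : IsClosed (I : Set B)) {b : B} (hb : b ∉ I) :
    ∃ f : B →ₚ[ℂ] ℂ, (∀ x ∈ I, f (star x * x) = 0) ∧ f (star b * b) ≠ 0 := by
  obtain ⟨g, hg, hgb⟩ := ProperCone.hyperplane_separation_point
    (⟨I.nonnegAddCone.closure, isClosed_closure⟩ : ProperCone ℝ B)
    (I.neg_star_mul_self_notMem_closure hI hb)
  have hgK (x : B) (hx : x ∈ I.nonnegAddCone) : 0 ≤ g x := hg x (subset_closure hx)
  have hgnn (p : B) (hp : 0 ≤ p) : 0 ≤ g p :=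
    hgK p ⟨p, 0, hp, .zero B, by simp [I.zero_mem], by simp⟩
  have hgz (x : B) (hx : x ∈ I) : g (star x * x) = 0 := by
    have hsI (s : ℝ) : s • (star x * x) ∈ I := by
      rw [← smul_mul_assoc]; exact I.mul_mem_left _ _ hx
    have hs (s : ℝ) : 0 ≤ g (s • (star x * x)) :=
      hgK _ ⟨0, s • (star x * x), le_rfl, (IsSelfAdjoint.all s).smul (.star_mul_self x),
        fun t ↦ by rw [smul_smul]; exact hsI _, by simp⟩
    have h1 := hs 1
    have h2 := hs (-1)
    simp only [map_smul, smul_eq_mul] at h1 h2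
    linarith
  set g' : Module.Dual ℝ B :=
    g.toLinearMap ∘ₗ (selfAdjoint.submodule ℝ B).subtype ∘ₗ (realPart : B →ₗ[ℝ] selfAdjoint B)
    with hg'
  have hsa (x : B) (hx : IsSelfAdjoint x) : (g'.extendRCLike : Module.Dual ℂ B) x = (g x : ℂ) := by
    have h1 : g' x = g x := congrArg g hx.coe_realPart
    have h2 : g' (Complex.I • x) = 0 := by
      change g ((ℜ (Complex.I • x) : selfAdjoint B) : B) = 0
      simp [realPart_I_smul, hx.imaginaryPart]
    rw [Module.Dual.extendRCLike_apply]
    simp [h1, h2]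
  have hpos (x : B) (hx : 0 ≤ x) : 0 ≤ (g'.extendRCLike : Module.Dual ℂ B) x := by
    rw [hsa x (.of_nonneg hx)]
    exact_mod_cast hgnn x hx
  refine ⟨.mk₀ g'.extendRCLike hpos, fun x hx ↦ ?_, ?_⟩
  · exact (hsa _ (.star_mul_self x)).trans (by simp [hgz x hx])
  · refine ne_of_eq_of_ne (hsa _ (.star_mul_self b)) ?_
    rw [map_neg] at hgb
    exact_mod_cast (by linarith : 0 < g (star b * b)).ne'

namespace PositiveLinearMap

variable (f : B →ₚ[ℂ] ℂ)

theorem gnsNonUnitalStarAlgHom_eq_zero_iff (b : B) :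
    f.gnsNonUnitalStarAlgHom b = 0 ↔ ∀ a, f (star (b * a) * (b * a)) = 0 := by
  have key (a : B) : ‖f.gnsNonUnitalStarAlgHom b (f.toPreGNS a)‖ ^ 2 =
      f (star (b * a) * (b * a)) := by
    rw [gnsNonUnitalStarAlgHom_apply_coe, UniformSpace.Completion.norm_coe, preGNS_norm_sq]
    simp
  refine ⟨fun h a ↦ by rw [← key, h]; simp, fun h ↦ ?_⟩
  ext v
  induction v using UniformSpace.Completion.induction_on with
  | hp => exact isClosed_eq (by fun_prop) (by fun_prop)
  | ih v =>
    have := key (f.ofPreGNS v)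
    rw [h, sq_eq_zero_iff, Complex.ofReal_eq_zero, norm_eq_zero] at this
    exact this

theorem apply_star_mul_self_of_gns_eq_zero {b : B} (h : f.gnsNonUnitalStarAlgHom b = 0) :
    f (star b * b) = 0 := by
  have hc : IsClosed {x : B | f (star x * x) = 0} :=
    isClosed_eq ((map_continuous f).comp (by fun_prop)) continuous_const
  refine hc.closure_subset_iff.mpr ?_ (mem_closure_range_mul_left b)
  rintro _ ⟨a, rfl⟩
  exact (f.gnsNonUnitalStarAlgHom_eq_zero_iff b).mp h a

end PositiveLinearMap

end Ideal

theorem StarRep.exists_apply_eq_zero_iff {B : Type u} [NonUnitalCStarAlgebra B]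
    (I : TwoSidedIdeal B) (hI : IsClosed (I : Set B)) :
    ∃ ρ : StarRep B, ∀ b, ρ.π b = 0 ↔ b ∈ I := by
  let _ := CStarAlgebra.spectralOrder B
  have _ := CStarAlgebra.spectralOrderedRing B
  choose f hfI hf using fun b : {b // b ∉ I} ↦ I.exists_positiveLinearMap hI b.2
  refine ⟨⟨lp (fun b ↦ (f b).GNS) 2, lp.directSumRep fun b ↦ (f b).gnsNonUnitalStarAlgHom⟩,
    fun b ↦ (lp.directSumRep_eq_zero_iff _ b).trans ⟨fun h ↦ ?_, fun hb i ↦ ?_⟩⟩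
  · by_contra hb
    exact hf ⟨b, hb⟩ ((f ⟨b, hb⟩).apply_star_mul_self_of_gns_eq_zero (h ⟨b, hb⟩))
  · exact ((f i).gnsNonUnitalStarAlgHom_eq_zero_iff b).mpr
      fun a ↦ hfI i _ (I.mul_mem_right _ _ hb)

theorem NonUnitalStarAlgHom.isClosed_ker {B C : Type*} [NonUnitalCStarAlgebra B]
    [NonUnitalCStarAlgebra C] (φ : B →⋆ₙₐ[ℂ] C) :
    IsClosed (TwoSidedIdeal.ker φ : Set B) := by
  convert isClosed_singleton.preimage φ.continuous using 1
  ext b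
  exact TwoSidedIdeal.mem_ker φ

/-- Let `A` be a dense `*`-subalgebra of a C*-algebra `B`.  The elements of
`R_A^B`, the `*`-representations of `A` extending to `B`, are exactly the restrictions to `A`
of `*`-representations `π̄` of `B` (the extension being unique by density).  Then:
(1) `A ⊆ B` has the ideal separation property iff for all `π, ϱ ∈ R_A^B`,
    `ker π ⊆ ker ϱ` in `A` implies `‖ϱ̄(b)‖ ≤ ‖π̄(b)‖` for all `b ∈ B`;
(2) `A ⊆ B` has the ideal intersection property iff for every `π ∈ R_A^B`,
    `ker π = {0}` in `A` implies `‖π̄(b)‖ = ‖b‖` for all `b ∈ B`. -/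
theorem norm_reformulations {B : Type u} [NonUnitalCStarAlgebra B]
    (A : NonUnitalStarSubalgebra ℂ B) (hA : Dense (A : Set B)) :
    (SepIdeals (A : Set B) ↔
      ∀ (ρ σ : StarRep B),
        ({a : ↥A | ρ.π (a : B) = 0} ⊆ {a : ↥A | σ.π (a : B) = 0}) →
          ∀ b : B, ‖σ.π b‖ ≤ ‖ρ.π b‖) ∧
    (DetIdeals (A : Set B) ↔
      ∀ ρ : StarRep B,
        (∀ a : ↥A, ρ.π (a : B) = 0 → a = 0) →
          ∀ b : B, ‖ρ.π b‖ = ‖b‖) := by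
  refine ⟨⟨fun hsep ρ σ hker ↦ ?_, fun h I J hI hJ hIJ ↦ ?_⟩,
    ⟨fun hdet ρ hker ↦ ?_, fun h I hI hne hIA ↦ hne ?_⟩⟩
  · refine ρ.π.norm_le_of_ker_le σ.π fun b hb ↦ ?_
    have heq := hsep (TwoSidedIdeal.ker ρ.π ⊓ TwoSidedIdeal.ker σ.π) (TwoSidedIdeal.ker ρ.π)
      (ρ.π.isClosed_ker.inter σ.π.isClosed_ker) ρ.π.isClosed_ker <| by
        ext a
        simp only [Set.mem_inter_iff, SetLike.mem_coe, TwoSidedIdeal.mem_inf,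
          TwoSidedIdeal.mem_ker]
        exact ⟨fun h ↦ ⟨h.1.1, h.2⟩, fun h ↦ ⟨⟨h.1, @hker ⟨a, h.2⟩ h.1⟩, h.2⟩⟩
    have hb' : b ∈ TwoSidedIdeal.ker ρ.π := (TwoSidedIdeal.mem_ker ρ.π).mpr hb
    rw [← heq, TwoSidedIdeal.mem_inf] at hb'
    exact (TwoSidedIdeal.mem_ker σ.π).mp hb'.2
  · obtain ⟨ρ, hρ⟩ := StarRep.exists_apply_eq_zero_iff I hI
    obtain ⟨σ, hσ⟩ := StarRep.exists_apply_eq_zero_iff J hJ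
    have hmem (a : A) : ρ.π (a : B) = 0 ↔ σ.π (a : B) = 0 := by
      have := Set.ext_iff.mp hIJ a
      simpa [hρ, hσ] using this
    ext b
    have hle := h ρ σ (fun a ↦ (hmem a).mp) b
    have hge := h σ ρ (fun a ↦ (hmem a).mpr) b
    rw [← hρ, ← hσ, ← norm_eq_zero, hge.antisymm hle, norm_eq_zero]
  · have hbot : TwoSidedIdeal.ker ρ.π = ⊥ := by
      by_contra hne
      refine hdet _ ρ.π.isClosed_ker hne (Set.eq_singleton_iff_unique_mem.mpr
        ⟨⟨zero_mem _, zero_mem A⟩, fun a ha ↦ ?_⟩)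
      exact congrArg Subtype.val (hker ⟨a, ha.2⟩ ((TwoSidedIdeal.mem_ker ρ.π).mp ha.1))
    have hinj : Function.Injective ρ.π := (injective_iff_map_eq_zero ρ.π).mpr fun b hb ↦ by
      have := (TwoSidedIdeal.mem_ker ρ.π).mpr hb
      rwa [hbot, TwoSidedIdeal.mem_bot] at this
    exact NonUnitalStarAlgHom.norm_map ρ.π hinj
  · obtain ⟨ρ, hρ⟩ := StarRep.exists_apply_eq_zero_iff I hI
    have hnorm := h ρ fun a ha ↦ by
      have : (a : B) ∈ (I : Set B) ∩ A := ⟨(hρ a).mp ha, a.2⟩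
      rw [hIA] at this
      exact Subtype.ext this
    ext b
    rw [← hρ, ← norm_eq_zero, hnorm, norm_eq_zero, TwoSidedIdeal.mem_bot]
end
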